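/- For every finitely presented group H and every natural number n ≥ 1, there exists a finitely presented group G such that H embeds into G and torlen(G) = n, i.e., tor_{n-1}(G) ≠ tor_n(G) and tor_n(G) = tor_{n+1}(G). Moreover, there exists a finitely presented group G' such that H embeds into G' and torlen(G') = ω, i.e., tor_m(G') ⊊ tor_{m+1}(G') for every m ∈ ℕ. -/

import Mathlib

/-- The ascending chain of normal subgroups `tor₀(G) = 1`,
`tor_{n+1}(G) = ⟪elements of finite order mod tor_n(G)⟫`. -/
def tor (G : Type*) [Group G] : ℕ → Subgroup G
  | 0 => ⊥
  | n + 1 => Subgroup.normalClosure {g : G | ∃ k : ℕ, 0 < k ∧ g ^ k ∈ tor G n}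

/-- A group is finitely presented if it is isomorphic to a `PresentedGroup` on finitely
many generators with finitely many relators. -/
def IsFinitelyPresentedGroup (H : Type*) [Group H] : Prop :=
  ∃ (m : ℕ) (S : Finset (FreeGroup (Fin m))),
    Nonempty (H ≃* PresentedGroup (S : Set (FreeGroup (Fin m))))

namespace HNNExtension

variable {G : Type*} [Group G] {A B : Subgroup G} (φ : A ≃* B)

/-- The product `t ^ u₁ * g₁ * t ^ u₂ * g₂ * ⋯` in an HNN extension. -/
def wordProd (L : List (ℤˣ × G)) : HNNExtension G A B φ :=
  (L.map fun x => (t : HNNExtension G A B φ) ^ (x.1 : ℤ) * of x.2).prod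

@[simp]
theorem wordProd_nil : wordProd φ ([] : List (ℤˣ × G)) = 1 := rfl

@[simp]
theorem wordProd_cons (x : ℤˣ × G) (L : List (ℤˣ × G)) :
    wordProd φ (x :: L) = t ^ (x.1 : ℤ) * of x.2 * wordProd φ L := by
  simp [wordProd]

@[simp]
theorem wordProd_append (L M : List (ℤˣ × G)) :
    wordProd φ (L ++ M) = wordProd φ L * wordProd φ M := by
  simp [wordProd]

/-- Two consecutive syllables of a word that do not form a pinch. -/
def NoPinch (A B : Subgroup G) (a b : ℤˣ × G) : Prop :=
  a.2 ∈ toSubgroup A B a.1 → a.1 = b.1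

theorem exists_wordProd (x : HNNExtension G A B φ) :
    ∃ (g : G) (L : List (ℤˣ × G)), L.IsChain (NoPinch A B) ∧ x = of g * wordProd φ L := by
  obtain ⟨d⟩ := NormalWord.TransversalPair.nonempty G A B
  obtain ⟨w, rfl⟩ := (NormalWord.equiv φ d).symm.surjective x
  exact ⟨w.head, w.toList, w.chain, rfl⟩

theorem eq_nil_of_mul_wordProd_mem_range {g : G} {L : List (ℤˣ × G)}
    (hL : L.IsChain (NoPinch A B))
    (h : of g * wordProd φ L ∈ (of.range : Subgroup (HNNExtension G A B φ))) : L = [] :=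
  ReducedWord.toList_eq_nil_of_mem_of_range φ ⟨g, L, hL⟩ h

theorem exists_zpow_mul_of (u : ℤˣ) {a : G} (ha : a ∈ toSubgroup A B u) :
    ∃ b : G, (t : HNNExtension G A B φ) ^ (u : ℤ) * of a = of b * t ^ (u : ℤ) := by
  rcases Int.units_eq_one_or u with rfl | rfl
  · exact ⟨φ ⟨a, ha⟩, by simpa using t_mul_of (φ := φ) ⟨a, ha⟩⟩
  · exact ⟨φ.symm ⟨a, ha⟩, by simpa using inv_t_mul_of (φ := φ) ⟨a, ha⟩⟩

theorem isChain_replace_last {L : List (ℤˣ × G)} {u : ℤˣ} {a : G}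
    (h : (L ++ [(u, a)]).IsChain (NoPinch A B)) (b : G) :
    (L ++ [(u, b)]).IsChain (NoPinch A B) := by
  rw [List.isChain_append] at h ⊢
  refine ⟨h.1, by simp, fun x hx y hy => ?_⟩
  have := h.2.2 x hx (u, a) (by simp)
  simp only [List.head?_cons, Option.mem_def, Option.some.injEq] at hy
  subst hy
  exact this

theorem wordProd_ne_one_pow {L : List (ℤˣ × G)} (hne : L ≠ [])
    (hL : L.IsChain (NoPinch A B))
    (hcyc : ∀ x ∈ L.getLast?, ∀ y ∈ L.head?, NoPinch A B x y) {k : ℕ} (hk : 0 < k) :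
    wordProd φ L ^ k ≠ 1 := by
  have key : ∀ k : ℕ, (List.replicate k L).flatten.IsChain (NoPinch A B) ∧
      wordProd φ (List.replicate k L).flatten = wordProd φ L ^ k ∧
      ∀ y ∈ (List.replicate k L).flatten.head?, y ∈ L.head? := by
    intro k
    induction k with
    | zero => simp
    | succ k ih =>
      obtain ⟨h1, h2, h3⟩ := ih
      refine ⟨?_, ?_, ?_⟩
      · rw [List.replicate_succ, List.flatten_cons, List.isChain_append]
        exact ⟨hL, h1, fun x hx y hy => hcyc x hx y (h3 y hy)⟩
      · rw [List.replicate_succ, List.flatten_cons, wordProd_append, h2, pow_succ']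
      · rw [List.replicate_succ, List.flatten_cons]
        obtain ⟨a, l, rfl⟩ := List.exists_cons_of_ne_nil hne
        simp
  intro h
  obtain ⟨h1, h2, -⟩ := key k
  have := eq_nil_of_mul_wordProd_mem_range φ (g := 1) h1
    (by rw [h2, h]; simp [one_mem])
  obtain ⟨m, rfl⟩ := Nat.exists_eq_succ_of_ne_zero hk.ne'
  simp [List.replicate_succ, hne] at this

theorem isConj_of_aux (n : ℕ) : ∀ (g : G) (L : List (ℤˣ × G)), L.length ≤ n →
    L.IsChain (NoPinch A B) → ∀ k : ℕ, 0 < k → (of g * wordProd φ L) ^ k = 1 →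
    ∃ a : G, IsConj (of a) (of g * wordProd φ L) := by
  induction n using Nat.strong_induction_on with
  | _ n ih =>
  intro g L hn hL k hk hpow
  rcases List.eq_nil_or_concat L with rfl | ⟨L', ⟨u, a⟩, rfl⟩
  · exact ⟨g, by rw [wordProd_nil, mul_one]⟩
  rw [List.concat_eq_append] at *
  have hconj : IsConj (of g * wordProd φ (L' ++ [(u, a)]))
      (wordProd φ (L' ++ [(u, a * g)])) :=
    isConj_iff.2 ⟨(of g)⁻¹, by simp [mul_assoc]⟩
  replace hL := isChain_replace_last hL (a * g)
  generalize a * g = a at hconj hL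
  have hpow' : wordProd φ (L' ++ [(u, a)]) ^ k = 1 := by
    have := hconj.pow k
    rw [hpow] at this
    exact (isConj_one_right.1 this)
  by_cases hcyc : ∀ x ∈ (L' ++ [(u, a)]).getLast?, ∀ y ∈ (L' ++ [(u, a)]).head?,
      NoPinch A B x y
  · exact absurd hpow' (wordProd_ne_one_pow φ (by simp) hL hcyc hk)
  cases L' with
  | nil => exact absurd (by simp [NoPinch]) hcyc
  | cons x M =>
    obtain ⟨v, b⟩ := x
    have hpinch : ¬ NoPinch A B (u, a) (v, b) := by
      rw [List.getLast?_concat] at hcyc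
      simpa using hcyc
    simp only [NoPinch, Classical.not_imp] at hpinch
    obtain ⟨c, hc⟩ := exists_zpow_mul_of φ u hpinch.1
    have hv : v = -u := by
      have := hpinch.2
      rcases Int.units_eq_one_or u with rfl | rfl <;>
        rcases Int.units_eq_one_or v with rfl | rfl <;> simp_all
    have hconj2 : IsConj (wordProd φ ((v, b) :: M ++ [(u, a)])) (of (c * b) * wordProd φ M) := by
      refine isConj_iff.2 ⟨of c * t ^ (u : ℤ), ?_⟩
      subst hv
      simp [hc, mul_assoc]
    have hc3 := hconj.trans hconj2
    obtain ⟨a', ha'⟩ := ih M.length (by simp at hn; omega) (c * b) M le_rfl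
      (List.isChain_append.1 (List.isChain_of_isChain_cons hL)).1 k hk (by
        have := hc3.pow k
        rw [hpow] at this
        exact isConj_one_right.1 this)
    exact ⟨a', ha'.trans hc3.symm⟩

/-- Torsion theorem for HNN extensions: every element of finite order is conjugate to an
element of the base group. -/
theorem exists_isConj_of_pow_eq_one {x : HNNExtension G A B φ} {k : ℕ} (hk : 0 < k)
    (hx : x ^ k = 1) : ∃ a : G, IsConj (of a) x := by
  obtain ⟨g, L, hL, rfl⟩ := exists_wordProd φ x
  exact isConj_of_aux φ _ g L le_rfl hL k hk hx

end HNNExtension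

/-- The isomorphism between the images of two injective homomorphisms with the same source. -/
noncomputable def MonoidHom.rangeEquiv {K G : Type*} [Group K] [Group G] {f g : K →* G}
    (hf : Function.Injective f) (hg : Function.Injective g) : f.range ≃* g.range :=
  (MonoidHom.ofInjective hf).symm.trans (MonoidHom.ofInjective hg)

theorem MonoidHom.rangeEquiv_apply {K G : Type*} [Group K] [Group G] {f g : K →* G}
    (hf : Function.Injective f) (hg : Function.Injective g) (k : K) :
    (MonoidHom.rangeEquiv hf hg ⟨f k, k, rfl⟩ : G) = g k := by
  have : (⟨f k, k, rfl⟩ : f.range) = MonoidHom.ofInjective hf k := rfl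
  rw [this, MonoidHom.rangeEquiv, MulEquiv.trans_apply, MulEquiv.symm_apply_apply]
  rfl

/-- The HNN extension of `G` whose stable letter `t` conjugates `f k` to `g k`. -/
abbrev HNNExtension.OfHoms {K G : Type*} [Group K] [Group G] (f g : K →* G)
    (hf : Function.Injective f) (hg : Function.Injective g) : Type _ :=
  HNNExtension G f.range g.range (MonoidHom.rangeEquiv hf hg)

/-- Every element of finite order lies in the normal closure of `ζ`. -/
def TorsionWithin {G : Type*} [Group G] (ζ : G) : Prop :=
  ∀ (g : G) (k : ℕ), 0 < k → g ^ k = 1 → g ∈ Subgroup.normalClosure {ζ}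

theorem TorsionWithin.prodMk {A C : Type*} [Group A] [Group C]
    (hA : ∀ (a : A) (k : ℕ), 0 < k → a ^ k = 1 → a = 1) {ζ : C} (h : TorsionWithin ζ) :
    TorsionWithin ((1, ζ) : A × C) := by
  rintro ⟨a, c⟩ k hk hac
  have h1 : a = 1 := hA a k hk (congrArg Prod.fst hac)
  have h2 := h c k hk (congrArg Prod.snd hac)
  have := Subgroup.mem_map_of_mem (MonoidHom.inr A C) h2
  subst h1
  have hle : Subgroup.normalClosure {ζ} ≤
      (Subgroup.normalClosure {((1, ζ) : A × C)}).comap (MonoidHom.inr A C) :=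
    Subgroup.normalClosure_le_normal (by
      simpa using Subgroup.subset_normalClosure (Set.mem_singleton ((1, ζ) : A × C)))
  exact hle h2

namespace HNNExtension

section OfHoms

variable {K G : Type*} [Group K] [Group G] {f g : K →* G}
  {hf : Function.Injective f} {hg : Function.Injective g}

theorem OfHoms.t_mul_of (k : K) :
    (t * of (f k) : OfHoms f g hf hg) = of (g k) * t := by
  have := HNNExtension.t_mul_of (φ := MonoidHom.rangeEquiv hf hg) ⟨f k, k, rfl⟩
  rwa [MonoidHom.rangeEquiv_apply] at this

/-- The homomorphism out of `OfHoms f g` determined by its values on `G` and on `t`. -/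
noncomputable def OfHoms.lift {H : Type*} [Group H] (F : G →* H) (x : H)
    (hx : ∀ k, x * F (f k) = F (g k) * x) : OfHoms f g hf hg →* H :=
  HNNExtension.lift F x (by
    rintro ⟨_, k, rfl⟩
    rw [MonoidHom.rangeEquiv_apply]
    exact hx k)

@[simp]
theorem OfHoms.lift_t {H : Type*} [Group H] (F : G →* H) (x : H)
    (hx : ∀ k, x * F (f k) = F (g k) * x) :
    OfHoms.lift F x hx (t : OfHoms f g hf hg) = x := HNNExtension.lift_t _ _ _

@[simp]
theorem OfHoms.lift_of {H : Type*} [Group H] (F : G →* H) (x : H)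
    (hx : ∀ k, x * F (f k) = F (g k) * x) (a : G) :
    OfHoms.lift F x hx (of a : OfHoms f g hf hg) = F a := HNNExtension.lift_of _ _ _ _

variable {K' G' : Type*} [Group K'] [Group G'] {f' g' : K' →* G'}
  {hf' : Function.Injective f'} {hg' : Function.Injective g'}

noncomputable def OfHoms.map (F : G →* G') (κ : K →* K') (h₁ : ∀ k, F (f k) = f' (κ k))
    (h₂ : ∀ k, F (g k) = g' (κ k)) : OfHoms f g hf hg →* OfHoms f' g' hf' hg' :=
  OfHoms.lift (of.comp F) t (fun k => by
    simp only [MonoidHom.comp_apply, h₁, h₂]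
    exact OfHoms.t_mul_of _)

@[simp]
theorem OfHoms.map_t (F : G →* G') (κ : K →* K') (h₁ : ∀ k, F (f k) = f' (κ k))
    (h₂ : ∀ k, F (g k) = g' (κ k)) :
    OfHoms.map F κ h₁ h₂ (t : OfHoms f g hf hg) = (t : OfHoms f' g' hf' hg') :=
  OfHoms.lift_t _ _ _

@[simp]
theorem OfHoms.map_of (F : G →* G') (κ : K →* K') (h₁ : ∀ k, F (f k) = f' (κ k))
    (h₂ : ∀ k, F (g k) = g' (κ k)) (a : G) :
    OfHoms.map F κ h₁ h₂ (of a : OfHoms f g hf hg) =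
      (of (F a) : OfHoms f' g' hf' hg') := OfHoms.lift_of _ _ _ _

end OfHoms

theorem torsionWithin_of {G : Type*} [Group G] {A B : Subgroup G} (φ : A ≃* B) {ζ : G}
    (h : TorsionWithin ζ) : TorsionWithin (of ζ : HNNExtension G A B φ) := by
  intro x k hk hx
  obtain ⟨a, ha⟩ := exists_isConj_of_pow_eq_one φ hk hx
  have hak : a ^ k = 1 := by
    have := ha.pow k
    rw [hx, ← map_pow] at this
    exact of_injective (φ := φ) (by rw [map_one]; exact isConj_one_left.1 this)
  have hle : Subgroup.normalClosure {ζ} ≤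
      (Subgroup.normalClosure {(of ζ : HNNExtension G A B φ)}).comap of :=
    Subgroup.normalClosure_le_normal (by
      simpa using Subgroup.subset_normalClosure (Set.mem_singleton
        (of ζ : HNNExtension G A B φ)))
  obtain ⟨c, rfl⟩ := isConj_iff.1 ha
  exact Subgroup.normalClosure_normal.conj_mem _ (hle (h a k hk hak)) c

end HNNExtension

namespace DyadicAffine

/-- Order automorphisms of the rationals. -/
abbrev OrderAut : Type := ℚ ≃o ℚ

theorem eq_one_of_pow_eq_one (a : OrderAut) (k : ℕ) (hk : 0 < k) (h : a ^ k = 1) : a = 1 := by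
  have up : ∀ (e : OrderAut) (q : ℚ), q < e q → ∀ n : ℕ, q < (e ^ (n + 1)) q := by
    intro e q hq n
    induction n with
    | zero => simpa using hq
    | succ n ih =>
      rw [pow_succ', RelIso.mul_apply]
      exact hq.trans (e.lt_iff_lt.2 ih)
  have down : ∀ (e : OrderAut) (q : ℚ), e q < q → ∀ n : ℕ, (e ^ (n + 1)) q < q := by
    intro e q hq n
    induction n with
    | zero => simpa using hq
    | succ n ih =>
      rw [pow_succ', RelIso.mul_apply]
      exact (e.lt_iff_lt.2 ih).trans hq
  obtain ⟨n, rfl⟩ := Nat.exists_eq_succ_of_ne_zero hk.ne'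
  ext q
  rcases lt_trichotomy (a q) q with hq | hq | hq
  · have := down a q hq n
    rw [h] at this
    exact absurd this (lt_irrefl q)
  · exact hq
  · have := up a q hq n
    rw [h] at this
    exact absurd this (lt_irrefl q)

/-- The translation `q ↦ q + 1`. -/
def trans : OrderAut := OrderIso.addRight (1 : ℚ)

/-- The homothety `q ↦ q / 2`. -/
def half : OrderAut := OrderIso.mulRight₀ (1 / 2 : ℚ) (by norm_num)

theorem half_mul_trans : half * (trans * trans) = trans * half := by
  ext q
  simp only [half, trans, RelIso.mul_apply, OrderIso.addRight_apply, OrderIso.mulRight₀_apply]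
  ring

/-- The translation `q ↦ q + 2⁻ⁱ`. -/
def dy (i : ℕ) : OrderAut := half ^ i * trans * (half ^ i)⁻¹

theorem dy_zero : dy 0 = trans := by simp [dy]

theorem dy_succ (i : ℕ) : dy (i + 1) = half * dy i * half⁻¹ := by
  simp [dy, pow_succ', mul_assoc]

theorem dy_succ_sq (i : ℕ) : dy (i + 1) ^ 2 = dy i := by
  induction i with
  | zero =>
    rw [dy_succ, dy_zero, conj_pow, mul_inv_eq_iff_eq_mul, sq, half_mul_trans]
  | succ i ih => rw [dy_succ (i + 1), conj_pow, ih, dy_succ i]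

theorem dy_pow (i : ℕ) : dy i ^ 2 ^ i = trans := by
  induction i with
  | zero => simp [dy_zero]
  | succ i ih => rw [pow_succ', pow_mul, dy_succ_sq, ih]

theorem trans_ne_one : trans ≠ 1 := by
  intro h
  have := congrArg (fun e : OrderAut => e 0) h
  simp [trans] at this

theorem dy_ne_one (i : ℕ) : dy i ≠ 1 := by
  intro h
  have := dy_pow i
  rw [h, one_pow] at this
  exact trans_ne_one this.symm

theorem zpow_injective {a : OrderAut} (ha : a ≠ 1) :
    Function.Injective (zpowersHom OrderAut a) := by
  rw [injective_iff_map_eq_one]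
  intro n hn
  simp only [zpowersHom_apply] at hn
  by_contra h
  have hne : n.toAdd ≠ 0 := h
  refine ha (eq_one_of_pow_eq_one a n.toAdd.natAbs (Int.natAbs_pos.2 hne) ?_)
  rcases Int.natAbs_eq n.toAdd with h' | h'
  · rw [← zpow_natCast, ← h', hn]
  · rw [← inv_inj, ← zpow_natCast, ← zpow_neg, ← h', hn, inv_one]

end DyadicAffine

namespace DyadicAffine

open HNNExtension

section Ext

variable {C : Type} [Group C]

/-- The homomorphism `(n, c) ↦ (bᵢⁿ, c)`. -/
def extSource (i : ℕ) (C : Type) [Group C] : Multiplicative ℤ × C →* OrderAut × C :=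
  (zpowersHom OrderAut (dy i)).prodMap (MonoidHom.id C)

/-- The homomorphism `(n, c) ↦ (bᵢⁿ, ζⁿ c)`, for central `ζ`. -/
def extTarget (i : ℕ) (ζ : C) (hζ : ∀ c, Commute ζ c) :
    Multiplicative ℤ × C →* OrderAut × C :=
  MonoidHom.mk' (fun p => (dy i ^ p.1.toAdd, ζ ^ p.1.toAdd * p.2)) (by
    rintro ⟨m, c⟩ ⟨n, d⟩
    ext1
    · simp [zpow_add]
    · have := ((hζ c).zpow_left n.toAdd).eq
      simp only [Prod.mk_mul_mk, toAdd_mul, zpow_add, mul_assoc]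
      rw [← mul_assoc c, ← this, mul_assoc])

@[simp]
theorem extSource_apply (i : ℕ) (p : Multiplicative ℤ × C) :
    extSource i C p = (dy i ^ p.1.toAdd, p.2) := by
  simp [extSource, MonoidHom.prodMap_def]

@[simp]
theorem extTarget_apply (i : ℕ) (ζ : C) (hζ : ∀ c, Commute ζ c) (p : Multiplicative ℤ × C) :
    extTarget i ζ hζ p = (dy i ^ p.1.toAdd, ζ ^ p.1.toAdd * p.2) := rfl

theorem extSource_injective (i : ℕ) (C : Type) [Group C] :
    Function.Injective (extSource i C) := by
  rintro ⟨m, c⟩ ⟨n, d⟩ h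
  simp only [extSource_apply, Prod.mk.injEq] at h
  have := zpow_injective (dy_ne_one i) (a₁ := m) (a₂ := n) (by simpa using h.1)
  rw [this, h.2]

theorem extTarget_injective (i : ℕ) (ζ : C) (hζ : ∀ c, Commute ζ c) :
    Function.Injective (extTarget i ζ hζ) := by
  rintro ⟨m, c⟩ ⟨n, d⟩ h
  simp only [extTarget_apply, Prod.mk.injEq] at h
  have := zpow_injective (dy_ne_one i) (a₁ := m) (a₂ := n) (by simpa using h.1)
  subst this
  rw [mul_left_cancel h.2]

/-- The HNN extension of `Aut(ℚ, <) × C` whose stable letter `x` commutes with `C` and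
satisfies `x bᵢ x⁻¹ = bᵢ ζ`. -/
abbrev Ext (i : ℕ) (ζ : C) (hζ : ∀ c, Commute ζ c) : Type :=
  OfHoms (extSource i C) (extTarget i ζ hζ) (extSource_injective i C)
    (extTarget_injective i ζ hζ)

variable {i : ℕ} {ζ : C} {hζ : ∀ c, Commute ζ c}

theorem Ext.t_mul_of (n : ℤ) (c : C) :
    (t * of (dy i ^ n, c) : Ext i ζ hζ) = of (dy i ^ n, ζ ^ n * c) * t := by
  simpa using OfHoms.t_mul_of (hf := extSource_injective i C)
    (hg := extTarget_injective i ζ hζ) (Multiplicative.ofAdd n, c)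

theorem Ext.commute_t (c : C) : Commute (t : Ext i ζ hζ) (of (1, c)) := by
  rw [commute_iff_eq]
  simpa using Ext.t_mul_of (i := i) (hζ := hζ) 0 c

theorem Ext.commute_of (a : OrderAut) (c : C) :
    Commute (of (a, 1) : Ext i ζ hζ) (of (1, c)) := by
  simp [commute_iff_eq, ← map_mul]

theorem Ext.central (p : Ext i ζ hζ) : Commute (of (1, ζ) : Ext i ζ hζ) p := by
  induction p using HNNExtension.induction_on with
  | of g =>
    obtain ⟨a, c⟩ := g
    simp [commute_iff_eq, ← map_mul, (hζ c).eq]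
  | t => exact (Ext.commute_t ζ).symm
  | mul x y hx hy => exact hx.mul_right hy
  | inv x hx => exact hx.inv_right

theorem Ext.zeta_sq (h : ζ ^ 2 = 1) : (of (1, ζ) : Ext i ζ hζ) ^ 2 = 1 := by
  rw [← map_pow, Prod.pow_mk, h, one_pow, Prod.mk_one_one, map_one]

theorem Ext.commute_t_sq (h : ζ ^ 2 = 1) : Commute (t : Ext i ζ hζ) (of (dy i ^ 2, 1)) := by
  have := Ext.t_mul_of (i := i) (hζ := hζ) 2 1
  rwa [zpow_ofNat, zpow_ofNat, h, one_mul] at this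

theorem Ext.torsion (h : TorsionWithin ζ) : TorsionWithin (of (1, ζ) : Ext i ζ hζ) :=
  torsionWithin_of _ (h.prodMk eq_one_of_pow_eq_one)

/-- A homomorphism out of `Ext i ζ` from its values on the base and the stable letter. -/
noncomputable def Ext.lift {H : Type} [Group H] (F : OrderAut × C →* H) (x : H)
    (h₁ : x * F (dy i, 1) = F (dy i, ζ) * x) (h₂ : ∀ c, Commute x (F (1, c))) :
    Ext i ζ hζ →* H :=
  OfHoms.lift F x (by
    rintro ⟨n, c⟩
    simp only [extSource_apply, extTarget_apply]
    have h3 : SemiconjBy x (F (dy i, 1) ^ n.toAdd) (F (dy i, ζ) ^ n.toAdd) :=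
      SemiconjBy.zpow_right h₁ _
    have h4 := h3.mul_right (h₂ c)
    rw [← map_zpow, ← map_zpow, ← map_mul, ← map_mul] at h4
    simpa using h4.eq)

@[simp]
theorem Ext.lift_of {H : Type} [Group H] (F : OrderAut × C →* H) (x : H)
    (h₁ : x * F (dy i, 1) = F (dy i, ζ) * x) (h₂ : ∀ c, Commute x (F (1, c)))
    (a : OrderAut × C) : Ext.lift F x h₁ h₂ (of a : Ext i ζ hζ) = F a := OfHoms.lift_of _ _ _ _

@[simp]
theorem Ext.lift_t {H : Type} [Group H] (F : OrderAut × C →* H) (x : H)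
    (h₁ : x * F (dy i, 1) = F (dy i, ζ) * x) (h₂ : ∀ c, Commute x (F (1, c))) :
    Ext.lift F x h₁ h₂ (t : Ext i ζ hζ) = x := OfHoms.lift_t _ _ _

variable {C' : Type} [Group C'] {ζ' : C'} {hζ' : ∀ c, Commute ζ' c}

/-- A homomorphism `σ : C →* C'` killing `ζ` induces a homomorphism
`Ext i ζ →* Ext (i + 1) ζ'` when `ζ' ^ 2 = 1`. -/
noncomputable def Ext.map (σ : C →* C') (hσ : σ ζ = 1) (h' : ζ' ^ 2 = 1) :
    Ext i ζ hζ →* Ext (i + 1) ζ' hζ' :=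
  Ext.lift (of.comp ((MonoidHom.id OrderAut).prodMap σ)) t
    (by
      have := Ext.commute_t_sq (i := i + 1) (hζ := hζ') h'
      rw [dy_succ_sq] at this
      simpa [hσ] using this.eq)
    (fun c => by simpa using Ext.commute_t (i := i + 1) (hζ := hζ') (σ c))

@[simp]
theorem Ext.map_of (σ : C →* C') (hσ : σ ζ = 1) (h' : ζ' ^ 2 = 1) (a : OrderAut) (c : C) :
    Ext.map σ hσ h' (of (a, c) : Ext i ζ hζ) = (of (a, σ c) : Ext (i + 1) ζ' hζ') := by
  simp [Ext.map]

@[simp]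
theorem Ext.map_t (σ : C →* C') (hσ : σ ζ = 1) (h' : ζ' ^ 2 = 1) :
    Ext.map σ hσ h' (t : Ext i ζ hζ) = (t : Ext (i + 1) ζ' hζ') := by
  simp [Ext.map]

theorem Ext.even_of_zpow_eq_one (h1 : ζ ≠ 1) (h2 : ζ ^ 2 = 1) {n : ℤ} (hn : ζ ^ n = 1) :
    ∃ m, n = 2 * m := by
  rcases Int.even_or_odd' n with ⟨m, rfl | rfl⟩
  · exact ⟨m, rfl⟩
  · rw [zpow_add, zpow_mul, zpow_ofNat, h2, one_zpow, one_mul, zpow_one] at hn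
    exact absurd hn h1

/-- If conjugation by the stable letter or its inverse maps an element of `Aut(ℚ, <)` into
`Aut(ℚ, <)`, then this element is a power of `bᵢ²`. -/
theorem Ext.exists_eq_of_conj (h1 : ζ ≠ 1) (h2 : ζ ^ 2 = 1) (u : ℤˣ) (a a' : OrderAut)
    (h : (t ^ (u : ℤ) * of (a, 1) * t ^ (-u : ℤ) : Ext i ζ hζ) = of (a', 1)) :
    ∃ m : ℤ, a = (dy i ^ 2) ^ m := by
  have hinj := of_injective
    (φ := MonoidHom.rangeEquiv (extSource_injective i C) (extTarget_injective i ζ hζ))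
  have hnc : ¬ ([(u, (a, 1)), (-u, 1)] : List (ℤˣ × (OrderAut × C))).IsChain
      (NoPinch (extSource i C).range (extTarget i ζ hζ).range) := by
    intro hch
    have := eq_nil_of_mul_wordProd_mem_range
      (MonoidHom.rangeEquiv (extSource_injective i C) (extTarget_injective i ζ hζ)) (g := 1) hch
      ⟨(a', 1), by simp [← h]⟩
    simp at this
  have hmem : (a, (1 : C)) ∈ toSubgroup (extSource i C).range (extTarget i ζ hζ).range u := by
    by_contra hc
    exact hnc (by simp [NoPinch, hc])
  rcases Int.units_eq_one_or u with rfl | rfl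
  · obtain ⟨⟨n, c⟩, hn⟩ := hmem
    simp only [extSource_apply, Prod.mk.injEq] at hn
    obtain ⟨rfl, rfl⟩ := hn
    have h3 := Ext.t_mul_of (i := i) (hζ := hζ) n.toAdd 1
    simp only [Units.val_one, zpow_one, zpow_neg] at h
    rw [h3, mul_inv_cancel_right] at h
    have h4 := congrArg Prod.snd (hinj h)
    simp only [mul_one] at h4
    obtain ⟨m, hm⟩ := Ext.even_of_zpow_eq_one h1 h2 h4
    exact ⟨m, by rw [hm, zpow_mul, zpow_ofNat]⟩
  · obtain ⟨⟨n, c⟩, hn⟩ := hmem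
    simp only [extTarget_apply, Prod.mk.injEq] at hn
    obtain ⟨rfl, hc⟩ := hn
    have h3 := Ext.t_mul_of (i := i) (hζ := hζ) n.toAdd c
    rw [hc] at h3
    simp only [Units.val_neg, Units.val_one, zpow_neg, zpow_one, inv_inv] at h
    rw [mul_assoc, ← h3, inv_mul_cancel_left] at h
    have h4 := congrArg Prod.snd (hinj h)
    simp only at h4
    rw [h4, mul_one] at hc
    obtain ⟨m, hm⟩ := Ext.even_of_zpow_eq_one h1 h2 hc
    exact ⟨m, by rw [hm, zpow_mul, zpow_ofNat]⟩

end Ext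

end DyadicAffine

namespace DyadicAffine

open HNNExtension

/-- `Ext` over the group of order two; `y bᵢ y⁻¹ = -bᵢ`. -/
abbrev E (i : ℕ) : Type := Ext i (-1 : ℤˣ) (fun c => Commute.all _ c)

/-- The central involution of `E i`. -/
noncomputable def zE (i : ℕ) : E i := of (1, -1)

/-- The canonical map `Aut(ℚ, <) → E i`. -/
noncomputable def inE (i : ℕ) : OrderAut →* E i := of.comp (MonoidHom.inl _ _)

/-- The stable letter of `E i`. -/
noncomputable def yE (i : ℕ) : E i := t

theorem zE_central (i : ℕ) (p : E i) : Commute (zE i) p := Ext.central p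

theorem zE_sq (i : ℕ) : zE i ^ 2 = 1 := Ext.zeta_sq (by simp)

theorem zE_ne_one (i : ℕ) : zE i ≠ 1 := by
  intro h
  rw [zE, ← map_one of] at h
  have := congrArg Prod.snd (of_injective _ h)
  exact absurd this (by decide)

theorem torsionWithin_zE (i : ℕ) : TorsionWithin (zE i) := by
  refine Ext.torsion ?_
  intro g k _ _
  rcases Int.units_eq_one_or g with rfl | rfl
  · exact one_mem _
  · exact Subgroup.subset_normalClosure rfl

theorem yE_mul (i : ℕ) : yE i * inE i (dy i) = zE i * inE i (dy i) * yE i := by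
  have := Ext.t_mul_of (i := i) (ζ := (-1 : ℤˣ)) (hζ := fun c => Commute.all _ c) 1 1
  simp only [zpow_one, mul_one] at this
  simp only [yE, inE, zE, MonoidHom.comp_apply, MonoidHom.inl_apply, this, ← map_mul,
    Prod.mk_mul_mk, one_mul, mul_one]

/-- The map `E i → E (i + 1)`. -/
noncomputable def mE (i : ℕ) : E i →* E (i + 1) := Ext.map 1 (by simp) (by simp)

@[simp]
theorem mE_zE (i : ℕ) : mE i (zE i) = 1 := by
  simp only [mE, zE, Ext.map_of, MonoidHom.one_apply, Prod.mk_one_one, map_one]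

@[simp]
theorem mE_inE (i : ℕ) (a : OrderAut) : mE i (inE i a) = inE (i + 1) a := by
  simp [mE, inE]

@[simp]
theorem mE_yE (i : ℕ) : mE i (yE i) = yE (i + 1) := by
  simp [mE, yE]

/-- `Ext` over `E i`; `x bᵢ x⁻¹ = ζ bᵢ`. -/
abbrev P (i : ℕ) : Type := Ext i (zE i) (zE_central i)

/-- The canonical map `Aut(ℚ, <) → P i`. -/
noncomputable def inP (i : ℕ) : OrderAut →* P i := of.comp (MonoidHom.inl _ _)

/-- The canonical map `E i → P i`. -/
noncomputable def incEP (i : ℕ) : E i →* P i := of.comp (MonoidHom.inr _ _)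

/-- The stable letter of `P i`. -/
noncomputable def xP (i : ℕ) : P i := t

/-- The central involution of `P i`. -/
noncomputable def zP (i : ℕ) : P i := incEP i (zE i)

theorem zP_sq (i : ℕ) : zP i ^ 2 = 1 := Ext.zeta_sq (zE_sq i)

theorem zP_central (i : ℕ) (p : P i) : Commute (zP i) p := Ext.central p

theorem inP_injective (i : ℕ) : Function.Injective (inP i) :=
  (of_injective _).comp (fun _ _ h => congrArg Prod.fst h)

theorem incEP_injective (i : ℕ) : Function.Injective (incEP i) :=
  (of_injective _).comp (fun _ _ h => congrArg Prod.snd h)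

theorem torsionWithin_zP (i : ℕ) : TorsionWithin (zP i) := Ext.torsion (torsionWithin_zE i)

theorem zP_ne_one (i : ℕ) : zP i ≠ 1 := fun h =>
  zE_ne_one i (incEP_injective i (by rw [map_one]; exact h))

theorem commute_inP_incEP (i : ℕ) (a : OrderAut) (e : E i) :
    Commute (inP i a) (incEP i e) := Ext.commute_of a e

theorem commute_xP_incEP (i : ℕ) (e : E i) : Commute (xP i) (incEP i e) := Ext.commute_t e

theorem commute_xP_sq (i : ℕ) : Commute (xP i) (inP i (dy i ^ 2)) :=
  Ext.commute_t_sq (zE_sq i)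

theorem xP_mul (i : ℕ) : xP i * inP i (dy i) = zP i * inP i (dy i) * xP i := by
  have := Ext.t_mul_of (i := i) (ζ := zE i) (hζ := zE_central i) 1 1
  simp only [zpow_one, mul_one] at this
  simp only [xP, inP, zP, incEP, MonoidHom.comp_apply, MonoidHom.inl_apply,
    MonoidHom.inr_apply, this, ← map_mul, Prod.mk_mul_mk, one_mul, mul_one]

/-- The map `P i → P (i + 1)`. -/
noncomputable def mP (i : ℕ) : P i →* P (i + 1) :=
  Ext.map (mE i) (mE_zE i) (zE_sq (i + 1))

@[simp]
theorem mP_inP (i : ℕ) (a : OrderAut) : mP i (inP i a) = inP (i + 1) a := by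
  simp [mP, inP]

@[simp]
theorem mP_incEP (i : ℕ) (e : E i) : mP i (incEP i e) = incEP (i + 1) (mE i e) := by
  simp [mP, incEP]

@[simp]
theorem mP_xP (i : ℕ) : mP i (xP i) = xP (i + 1) := by
  simp [mP, xP]

/-- The HNN extension of `P i` by a letter `s` centralising `Aut(ℚ, <)`. -/
abbrev PS (i : ℕ) : Type :=
  OfHoms (inP i) (inP i) (inP_injective i) (inP_injective i)

/-- The canonical map `P i → PS i`. -/
noncomputable def incPS (i : ℕ) : P i →* PS i := of

/-- The stable letter of `PS i`. -/
noncomputable def sPS (i : ℕ) : PS i := t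

theorem incPS_injective (i : ℕ) : Function.Injective (incPS i) := of_injective _

theorem commute_sPS (i : ℕ) (a : OrderAut) : Commute (sPS i) (incPS i (inP i a)) :=
  OfHoms.t_mul_of (hf := inP_injective i) (hg := inP_injective i) a

/-- The map `PS i → PS (i + 1)`. -/
noncomputable def mPS (i : ℕ) : PS i →* PS (i + 1) :=
  OfHoms.map (mP i) (MonoidHom.id _) (by simp) (by simp)

@[simp]
theorem mPS_incPS (i : ℕ) (p : P i) : mPS i (incPS i p) = incPS (i + 1) (mP i p) :=
  OfHoms.map_of _ _ _ _ _

@[simp]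
theorem mPS_sPS (i : ℕ) : mPS i (sPS i) = sPS (i + 1) :=
  OfHoms.map_t _ _ _ _

theorem zpow_sq_injective (i : ℕ) :
    Function.Injective (zpowersHom OrderAut (dy i ^ 2)) :=
  zpow_injective (fun h => dy_ne_one i (eq_one_of_pow_eq_one _ 2 two_pos h))

/-- The HNN extension of `Aut(ℚ, <)` by a letter `u` centralising `bᵢ²`. -/
abbrev R (i : ℕ) : Type := OfHoms (zpowersHom OrderAut (dy i ^ 2))
  (zpowersHom OrderAut (dy i ^ 2)) (zpow_sq_injective i) (zpow_sq_injective i)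

/-- The canonical map `Aut(ℚ, <) → R i`. -/
noncomputable def inR (i : ℕ) : OrderAut →* R i := of

/-- The stable letter of `R i`. -/
noncomputable def uR (i : ℕ) : R i := t

theorem commute_uR (i : ℕ) : Commute (uR i) (inR i (dy i ^ 2)) := by
  have := OfHoms.t_mul_of (hf := zpow_sq_injective i) (hg := zpow_sq_injective i)
    (Multiplicative.ofAdd 1)
  rw [zpowersHom_apply, toAdd_ofAdd, zpow_one] at this
  exact this

/-- A homomorphism out of `R i` from its values on the base and the stable letter. -/
noncomputable def liftR (i : ℕ) {H : Type} [Group H] (F : OrderAut →* H) (u : H)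
    (h : Commute u (F (dy i ^ 2))) : R i →* H :=
  OfHoms.lift F u (fun k => by
    have := h.zpow_right k.toAdd
    rw [← map_zpow] at this
    simpa using this.eq)

@[simp]
theorem liftR_inR (i : ℕ) {H : Type} [Group H] (F : OrderAut →* H) (u : H)
    (h : Commute u (F (dy i ^ 2))) (a : OrderAut) : liftR i F u h (inR i a) = F a :=
  OfHoms.lift_of _ _ _ _

@[simp]
theorem liftR_uR (i : ℕ) {H : Type} [Group H] (F : OrderAut →* H) (u : H)
    (h : Commute u (F (dy i ^ 2))) : liftR i F u h (uR i) = u :=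
  OfHoms.lift_t _ _ _

theorem R_hom_ext (i : ℕ) {H : Type} [Group H] {F F' : R i →* H}
    (h₁ : ∀ a, F (inR i a) = F' (inR i a)) (h₂ : F (uR i) = F' (uR i)) : F = F' :=
  HNNExtension.hom_ext (MonoidHom.ext h₁) h₂

/-- The map `R i → R (i + 1)`. -/
noncomputable def mR (i : ℕ) : R i →* R (i + 1) :=
  liftR i (inR (i + 1)) (uR (i + 1)) (by
    have h : inR (i + 1) (dy i ^ 2) = inR (i + 1) (dy (i + 1) ^ 2) ^ 2 :=
      (congrArg (inR (i + 1)) (by rw [dy_succ_sq])).trans (map_pow _ (dy (i + 1) ^ 2) 2)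
    rw [h]
    exact (commute_uR (i + 1)).pow_right 2)

/-- The embedding `R i → PS i` with `u ↦ x s x`. -/
noncomputable def f₁ (i : ℕ) : R i →* PS i :=
  liftR i ((incPS i).comp (inP i)) (incPS i (xP i) * sPS i * incPS i (xP i)) (by
    have h := (commute_xP_sq i).map (incPS i)
    exact (h.mul_left (commute_sPS i _)).mul_left h)

/-- The homomorphism `R i → P i` with `u ↦ x y`. -/
noncomputable def f₂ (i : ℕ) : R i →* P i :=
  liftR i (((inP i).noncommCoprod ((incEP i).comp (inE i))
      (fun _ _ => commute_inP_incEP _ _ _)).comp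
        ((MonoidHom.id OrderAut).prod (MonoidHom.id OrderAut)
          |>.comp (MulAut.conj half).toMonoidHom))
    (xP i * incEP i (yE i)) (by
    have hd : half * dy i ^ 2 * half⁻¹ = dy i := by
      rw [← conj_pow, ← dy_succ, dy_succ_sq]
    have h1 := congrArg (incEP i) (yE_mul i)
    simp only [map_mul] at h1
    simp only [MonoidHom.comp_apply, MonoidHom.prod_apply, MonoidHom.id_apply,
      MonoidHom.noncommCoprod_apply, MulEquiv.coe_toMonoidHom, MulAut.conj_apply, hd]
    have h2 := xP_mul i
    have h3 := zP_sq i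
    have e1 := (commute_inP_incEP i (dy i) (yE i)).eq
    have e2 := (commute_xP_incEP i (inE i (dy i))).eq
    have e3 := (zP_central i (xP i)).eq
    have e4 := (zP_central i (inP i (dy i))).eq
    have e5 := (commute_inP_incEP i (dy i) (inE i (dy i))).eq
    change incEP i (yE i) * incEP i (inE i (dy i)) =
      zP i * incEP i (inE i (dy i)) * incEP i (yE i) at h1
    generalize zP i = z at *
    generalize incEP i (yE i) = y at *
    generalize incEP i (inE i (dy i)) = c at *
    generalize inP i (dy i) = b at *
    generalize xP i = x at *
    rw [commute_iff_eq]
    calc x * y * (b * c) = x * (y * b) * c := by group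
      _ = (x * b) * (y * c) := by rw [← e1]; group
      _ = z * b * (x * z) * c * y := by rw [h2, h1]; group
      _ = z * (b * z) * (x * c) * y := by rw [← e3]; group
      _ = z ^ 2 * b * c * x * y := by rw [← e4, e2, sq]; group
      _ = b * c * (x * y) := by rw [h3]; group)

/-- A left inverse of `f₂`. -/
noncomputable def g₂ (i : ℕ) : P i →* R i :=
  Ext.lift ((inR i).comp ((MulAut.conj half⁻¹).toMonoidHom.comp (MonoidHom.fst _ _))) (uR i)
    (by
      have hd : half⁻¹ * dy i * half = dy i ^ 2 := by
        have : dy i = half * dy i ^ 2 * half⁻¹ := by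
          rw [← conj_pow, ← dy_succ, dy_succ_sq]
        conv_lhs => rw [this]
        group
      simpa [hd] using (commute_uR i).eq)
    (by simp)

theorem g₂_f₂ (i : ℕ) (r : R i) : g₂ i (f₂ i r) = r := by
  have : (g₂ i).comp (f₂ i) = MonoidHom.id _ := by
    refine R_hom_ext i (fun a => ?_) ?_
    · simp [f₂, g₂, inP, incEP, ← mul_assoc]
    · simp [f₂, g₂, xP, incEP]
  exact DFunLike.congr_fun this r

theorem f₂_injective (i : ℕ) : Function.Injective (f₂ i) :=
  Function.LeftInverse.injective (g₂_f₂ i)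

end DyadicAffine

namespace DyadicAffine

open HNNExtension

theorem f₁_uR (i : ℕ) :
    f₁ i (uR i) = incPS i (xP i) * sPS i * incPS i (xP i) := liftR_uR _ _ _ _

theorem f₁_uR_zpow (i : ℕ) (u : ℤˣ) : f₁ i (uR i ^ (u : ℤ)) =
    incPS i (xP i ^ (u : ℤ)) * sPS i ^ (u : ℤ) * incPS i (xP i ^ (u : ℤ)) := by
  rcases Int.units_eq_one_or u with rfl | rfl <;> simp [f₁_uR, mul_assoc]

theorem f₁_inR (i : ℕ) (a : OrderAut) : f₁ i (inR i a) = incPS i (inP i a) :=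
  liftR_inR _ _ _ _ _

theorem toSubgroup_self {G : Type*} [Group G] (A : Subgroup G) (u : ℤˣ) :
    toSubgroup A A u = A := by
  rcases Int.units_eq_one_or u with rfl | rfl <;> rfl

/-- The product of a word in `R i`. -/
noncomputable def wordR (i : ℕ) (L : List (ℤˣ × OrderAut)) : R i := wordProd _ L

/-- The product of a word in `PS i`. -/
noncomputable def wordPS (i : ℕ) (L : List (ℤˣ × P i)) : PS i := wordProd _ L

theorem wordR_cons (i : ℕ) (u : ℤˣ) (g : OrderAut) (L : List (ℤˣ × OrderAut)) :
    wordR i ((u, g) :: L) = uR i ^ (u : ℤ) * inR i g * wordR i L := wordProd_cons _ _ _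

theorem wordPS_cons (i : ℕ) (u : ℤˣ) (g : P i) (L : List (ℤˣ × P i)) :
    wordPS i ((u, g) :: L) = sPS i ^ (u : ℤ) * incPS i g * wordPS i L := wordProd_cons _ _ _

theorem exists_f₁_wordR (i : ℕ) (L : List (ℤˣ × OrderAut)) :
    L.IsChain (NoPinch (zpowersHom OrderAut (dy i ^ 2)).range
      (zpowersHom OrderAut (dy i ^ 2)).range) → ∀ p : P i,
    ∃ (p' : P i) (L' : List (ℤˣ × P i)),
      L'.IsChain (NoPinch (inP i).range (inP i).range) ∧
      incPS i p * f₁ i (wordR i L) = incPS i p' * wordPS i L' ∧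
      (L' = [] ↔ L = []) ∧
      ∀ x ∈ L.head?, p' = p * xP i ^ (x.1 : ℤ) ∧ L'.head?.map Prod.fst = some x.1 := by
  induction L with
  | nil => exact fun _ p => ⟨p, [], by simp [wordR, wordPS]⟩
  | cons x M ih =>
    obtain ⟨u, g⟩ := x
    intro hL p
    obtain ⟨q, M', hM', hq, hnil, hhead⟩ :=
      ih (List.isChain_of_isChain_cons hL) (xP i ^ (u : ℤ) * inP i g)
    refine ⟨p * xP i ^ (u : ℤ), (u, q) :: M', ?_, ?_, by simp, by simp⟩
    · rw [List.isChain_cons] at hL ⊢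
      refine ⟨?_, hM'⟩
      rintro ⟨v, q'⟩ hv hmem
      rw [toSubgroup_self] at hmem
      obtain ⟨a', ha'⟩ := hmem
      cases M with
      | nil => simp [hnil.2 rfl] at hv
      | cons y N =>
        obtain ⟨w, h⟩ := y
        obtain ⟨hq', hw⟩ := hhead (w, h) (by simp)
        obtain rfl : v = w := by
          rw [Option.mem_def] at hv
          simpa [hv] using hw
        by_contra huv
        have hvu : v = -u := by
          rcases Int.units_eq_one_or u with rfl | rfl <;>
            rcases Int.units_eq_one_or v with rfl | rfl <;> simp_all
        subst hvu
        simp only [Units.val_neg] at hq'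
        obtain ⟨m, hm⟩ := Ext.exists_eq_of_conj (zE_ne_one i) (zE_sq i) u g a'
          (hq'.symm.trans ha'.symm)
        refine huv (hL.1 (-u, h) (by simp) ?_)
        rw [toSubgroup_self]
        exact ⟨Multiplicative.ofAdd m, by simp [hm]⟩
    · rw [wordR_cons, wordPS_cons, map_mul, map_mul, f₁_uR_zpow, f₁_inR,
        mul_assoc (sPS i ^ (u : ℤ)), ← hq]
      simp only [map_mul, mul_assoc]

theorem f₁_injective (i : ℕ) : Function.Injective (f₁ i) := by
  rw [injective_iff_map_eq_one]
  intro r hr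
  obtain ⟨g, L, hL, hr'⟩ := exists_wordProd _ r
  replace hr' : r = inR i g * wordR i L := hr'
  subst hr'
  obtain ⟨p', L', hL', hp, hnil, -⟩ := exists_f₁_wordR i L hL (inP i g)
  rw [map_mul, f₁_inR, hp] at hr
  have hL'nil : L' = [] := eq_nil_of_mul_wordProd_mem_range _ hL' (g := p')
    ⟨1, (map_one (incPS i)).trans hr.symm⟩
  obtain rfl := hnil.1 hL'nil
  have hR : wordR i [] = 1 := rfl
  rw [← hp, hR, map_one, mul_one] at hr
  have hg : g = 1 := inP_injective i (incPS_injective i (by rw [hr, map_one, map_one]))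
  rw [hg, hR, map_one, mul_one]

theorem f₂_inR (i : ℕ) (a : OrderAut) :
    f₂ i (inR i a) = inP i (half * a * half⁻¹) * incEP i (inE i (half * a * half⁻¹)) := by
  simp [f₂]

theorem f₂_uR (i : ℕ) : f₂ i (uR i) = xP i * incEP i (yE i) := liftR_uR _ _ _ _

theorem mPS_f₁ (i : ℕ) (r : R i) : mPS i (f₁ i r) = f₁ (i + 1) (mR i r) := by
  have : (mPS i).comp (f₁ i) = (f₁ (i + 1)).comp (mR i) :=
    R_hom_ext i (by simp [f₁_inR, mR]) (by simp [f₁_uR, mR])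
  exact DFunLike.congr_fun this r

theorem mP_f₂ (i : ℕ) (r : R i) : mP i (f₂ i r) = f₂ (i + 1) (mR i r) := by
  have : (mP i).comp (f₂ i) = (f₂ (i + 1)).comp (mR i) :=
    R_hom_ext i (by simp [f₂_inR, mR]) (by simp [f₂_uR, mR])
  exact DFunLike.congr_fun this r

/-- The HNN extension of `PS i` by a letter `r` conjugating `f₁` to `f₂`. -/
abbrev Q (i : ℕ) : Type := OfHoms (f₁ i) ((incPS i).comp (f₂ i)) (f₁_injective i)
  ((incPS_injective i).comp (f₂_injective i))

/-- The canonical map `PS i → Q i`. -/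
noncomputable def incQ (i : ℕ) : PS i →* Q i := of

/-- The stable letter of `Q i`. -/
noncomputable def rQ (i : ℕ) : Q i := t

theorem rQ_mul (i : ℕ) (k : R i) :
    rQ i * incQ i (f₁ i k) = incQ i (incPS i (f₂ i k)) * rQ i :=
  OfHoms.t_mul_of (hf := f₁_injective i) (hg := (incPS_injective i).comp (f₂_injective i)) k

/-- The map `Q i → Q (i + 1)`. -/
noncomputable def mQ (i : ℕ) : Q i →* Q (i + 1) :=
  OfHoms.map (mPS i) (mR i) (mPS_f₁ i) (by simp [mP_f₂])

@[simp]
theorem mQ_incQ (i : ℕ) (p : PS i) : mQ i (incQ i p) = incQ (i + 1) (mPS i p) :=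
  OfHoms.map_of _ _ _ _ _

@[simp]
theorem mQ_rQ (i : ℕ) : mQ i (rQ i) = rQ (i + 1) := OfHoms.map_t _ _ _ _

theorem torsionWithin_zQ (i : ℕ) : TorsionWithin (incQ i (incPS i (zP i))) :=
  torsionWithin_of _ (torsionWithin_of _ (torsionWithin_zP i))

theorem mQ_eq_one_of_pow_eq_one (i : ℕ) (q : Q i) (k : ℕ) (hk : 0 < k) (h : q ^ k = 1) :
    mQ i q = 1 := by
  have h1 := torsionWithin_zQ i q k hk h
  have h2 : Subgroup.normalClosure {incQ i (incPS i (zP i))} ≤ (mQ i).ker :=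
    Subgroup.normalClosure_le_normal (by simp [zP, MonoidHom.mem_ker])
  exact h2 h1

theorem incQ_zP_ne_one (i : ℕ) : incQ i (incPS i (zP i)) ≠ 1 := fun h =>
  zP_ne_one i (incPS_injective i (of_injective _ (by rw [map_one, map_one]; exact h)))

end DyadicAffine

section Tor

theorem tor_normal (G : Type*) [Group G] (n : ℕ) : (tor G n).Normal := by
  cases n with
  | zero => exact Subgroup.normal_bot
  | succ n => exact Subgroup.normalClosure_normal

theorem mem_tor_succ_of_pow_mem {G : Type*} [Group G] {n k : ℕ} (hk : 0 < k) {g : G}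
    (h : g ^ k ∈ tor G n) : g ∈ tor G (n + 1) :=
  Subgroup.subset_normalClosure ⟨k, hk, h⟩

theorem tor_le_succ (G : Type*) [Group G] (n : ℕ) : tor G n ≤ tor G (n + 1) := fun g hg =>
  mem_tor_succ_of_pow_mem one_pos (by rwa [pow_one])

theorem map_mem_tor {G H : Type*} [Group G] [Group H] (φ : G →* H) (n : ℕ) :
    ∀ {g : G}, g ∈ tor G n → φ g ∈ tor H n := by
  induction n with
  | zero =>
    intro g hg
    rw [tor, Subgroup.mem_bot] at hg ⊢
    rw [hg, map_one]
  | succ n ih =>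
    intro g hg
    have : (tor H (n + 1)).Normal := tor_normal H _
    have hle : tor G (n + 1) ≤ (tor H (n + 1)).comap φ :=
      Subgroup.normalClosure_le_normal (by
        rintro g ⟨k, hk, hg⟩
        exact mem_tor_succ_of_pow_mem hk (by rw [← map_pow]; exact ih hg))
    exact hle hg

theorem tor_le_ker_of_tower {G : Type*} [Group G] {Q : ℕ → Type*} [∀ i, Group (Q i)]
    (ψ : ∀ i, G →* Q i) (m : ∀ i, Q i →* Q (i + 1)) (hψ : ∀ i g, m i (ψ i g) = ψ (i + 1) g)
    (hm : ∀ (i : ℕ) (q : Q i) (k : ℕ), 0 < k → q ^ k = 1 → m i q = 1) (i : ℕ) :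
    tor G i ≤ (ψ i).ker := by
  induction i with
  | zero => exact bot_le
  | succ i ih =>
    refine Subgroup.normalClosure_le_normal ?_
    rintro g ⟨k, hk, hg⟩
    have h := ih hg
    rw [MonoidHom.mem_ker, map_pow] at h
    change ψ (i + 1) g = 1
    rw [← hψ]
    exact hm i _ k hk h

end Tor

section Tower

variable {Γ : Type*} [Group Γ]

/-- The defining equations of a finitely presented group of torsion length `ω`. -/
structure TowerEquations (x b t y c d s r : Γ) : Prop where
  half : t * (b * b) = b * t
  x_y : Commute x y
  x_c : Commute x c
  x_d : Commute x d
  b_y : Commute b y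
  b_c : Commute b c
  b_d : Commute b d
  t_y : Commute t y
  t_c : Commute t c
  t_d : Commute t d
  s_b : Commute s b
  s_t : Commute s t
  r_x : r * (x * s * x) = x * y * r
  r_b : r * b = t * b * t⁻¹ * (d * c * d⁻¹) * r
  r_t : r * t = t * d * r
  invol : (x * b * x⁻¹ * b⁻¹) ^ 2 = 1

/-- The conjugate `tᵐ b t⁻ᵐ`. -/
def conjPow (t b : Γ) (m : ℕ) : Γ := t ^ m * b * (t ^ m)⁻¹

theorem conjPow_succ (t b : Γ) (m : ℕ) :
    conjPow t b (m + 1) = t * conjPow t b m * t⁻¹ := by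
  simp [conjPow, pow_succ', mul_assoc]

theorem Commute.conjPow {a t b : Γ} (ht : Commute a t) (hb : Commute a b) (m : ℕ) :
    Commute a (conjPow t b m) :=
  ((ht.pow_right m).mul_right hb).mul_right (ht.pow_right m).inv_right

theorem sq_comm_eq_one_of_conj {x y s r B B' C' : Γ} (hB : B' ^ 2 = B) (hx : Commute x B)
    (hs : Commute s B) (hr : r * (x * s * x) = x * y * r) (hrB : r * B = B' * C' * r)
    (xC : Commute x C') (By : Commute B' y) (BC : Commute B' C') :
    (x * B' * x⁻¹ * B'⁻¹) ^ 2 = 1 := by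
  have h1 : Commute (x * s * x) B := (hx.mul_left hs).mul_left hx
  have h2 : Commute (x * y) (B' * C') := by
    have e1 : x * y = r * (x * s * x) * r⁻¹ := by rw [hr]; group
    have e2 : B' * C' = r * B * r⁻¹ := by rw [hrB]; group
    rw [e1, e2]
    exact (Commute.conj_iff r).2 h1
  have h3 : (B' * x)⁻¹ * (x * B') = C' * y * (y * C')⁻¹ := by
    rw [inv_mul_eq_iff_eq_mul, ← mul_assoc, eq_mul_inv_iff_mul_eq]
    calc x * B' * (y * C') = x * (B' * y) * C' := by group
      _ = x * y * (B' * C') := by rw [By.eq]; group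
      _ = B' * C' * (x * y) := h2.eq
      _ = B' * (C' * x) * y := by group
      _ = B' * x * (C' * y) := by rw [← xC.eq]; group
  set v := (B' * x)⁻¹ * (x * B') with hv
  have hvB : Commute B' v := by
    rw [h3]
    exact (BC.mul_right By).mul_right (By.mul_right BC).inv_right
  have h4 : x⁻¹ * B'⁻¹ * x = v * B'⁻¹ := by rw [hv]; group
  have h5 : x⁻¹ * B⁻¹ * x = v ^ 2 * B⁻¹ := by
    have h6 := (hvB.symm.inv_right).mul_pow 2
    rw [← h4, inv_pow, hB] at h6
    rw [← h6, ← hB, sq, sq]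
    group
  have h7 : v ^ 2 = 1 := by
    rw [mul_assoc, ← hx.symm.inv_left.eq.symm] at h5
    have : B⁻¹ = v ^ 2 * B⁻¹ := by rw [← h5]; group
    exact (mul_eq_right.1 this.symm)
  have h8 : x * B' * x⁻¹ * B'⁻¹ = (B' * x) * v * (B' * x)⁻¹ := by rw [hv]; group
  rw [h8, conj_pow, h7]
  group

namespace TowerEquations

variable {x b t y c d s r : Γ}

theorem conjPow_succ_sq (h : TowerEquations x b t y c d s r) (m : ℕ) :
    conjPow t b (m + 1) ^ 2 = conjPow t b m := by
  induction m with
  | zero =>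
    rw [conjPow_succ, conj_pow, mul_inv_eq_iff_eq_mul]
    simpa [conjPow, sq] using h.half
  | succ m ih => rw [conjPow_succ t b (m + 1), conj_pow, ih, conjPow_succ]

theorem r_conjPow (h : TowerEquations x b t y c d s r) (m : ℕ) :
    r * conjPow t b m = conjPow t b (m + 1) * conjPow d c (m + 1) * r := by
  induction m with
  | zero => simpa [conjPow] using h.r_b
  | succ m ih =>
    have e1 : r * t * r⁻¹ = t * d := by rw [h.r_t]; group
    have e2 : r * conjPow t b m * r⁻¹ = conjPow t b (m + 1) * conjPow d c (m + 1) := by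
      rw [ih]; group
    have c1 : Commute d (conjPow t b (m + 1)) := h.t_d.symm.conjPow h.b_d.symm _
    have c2 : Commute t (conjPow d c (m + 1)) := h.t_d.conjPow h.t_c _
    rw [← mul_inv_eq_iff_eq_mul]
    calc r * conjPow t b (m + 1) * r⁻¹
        = (r * t * r⁻¹) * (r * conjPow t b m * r⁻¹) * (r * t * r⁻¹)⁻¹ := by
          rw [conjPow_succ]; group
      _ = t * (d * conjPow t b (m + 1)) * conjPow d c (m + 1) * d⁻¹ * t⁻¹ := by
          rw [e1, e2]; group
      _ = t * conjPow t b (m + 1) * t⁻¹ *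
            (t * (d * conjPow d c (m + 1) * d⁻¹)) * t⁻¹ := by rw [c1.eq]; group
      _ = conjPow t b (m + 2) * conjPow d c (m + 2) := by
          rw [← conjPow_succ d, ((h.t_d.conjPow h.t_c (m + 2)) : Commute t _).eq,
            ← conjPow_succ]
          group

theorem sq_comm_eq_one (h : TowerEquations x b t y c d s r) {m : ℕ}
    (hm : Commute x (conjPow t b m)) :
    (x * conjPow t b (m + 1) * x⁻¹ * (conjPow t b (m + 1))⁻¹) ^ 2 = 1 :=
  sq_comm_eq_one_of_conj (h.conjPow_succ_sq m) hm (h.s_t.conjPow h.s_b m) h.r_x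
    (h.r_conjPow m) (h.x_d.conjPow h.x_c _)
    (h.t_y.symm.conjPow h.b_y.symm _).symm
    (((h.t_d.symm.conjPow h.b_d.symm _).symm).conjPow
      ((h.t_c.symm.conjPow h.b_c.symm _).symm) _)

theorem map (h : TowerEquations x b t y c d s r) {Δ : Type*} [Group Δ]
    (φ : Γ →* Δ) :
    TowerEquations (φ x) (φ b) (φ t) (φ y) (φ c) (φ d) (φ s) (φ r) where
  half := by simpa only [map_mul] using congrArg φ h.half
  x_y := h.x_y.map φ
  x_c := h.x_c.map φ
  x_d := h.x_d.map φ
  b_y := h.b_y.map φ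
  b_c := h.b_c.map φ
  b_d := h.b_d.map φ
  t_y := h.t_y.map φ
  t_c := h.t_c.map φ
  t_d := h.t_d.map φ
  s_b := h.s_b.map φ
  s_t := h.s_t.map φ
  r_x := by simpa only [map_mul] using congrArg φ h.r_x
  r_b := by simpa only [map_mul, map_inv] using congrArg φ h.r_b
  r_t := by simpa only [map_mul] using congrArg φ h.r_t
  invol := by simpa only [map_mul, map_inv, map_pow, map_one] using congrArg φ h.invol

theorem comm_mem_tor (h : TowerEquations x b t y c d s r) (m : ℕ) :
    x * conjPow t b m * x⁻¹ * (conjPow t b m)⁻¹ ∈ tor Γ (m + 1) := by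
  induction m with
  | zero =>
    refine mem_tor_succ_of_pow_mem two_pos ?_
    have := h.invol
    simp only [conjPow, pow_zero, one_mul, inv_one, mul_one]
    rw [this]
    exact one_mem _
  | succ m ih =>
    have : (tor Γ (m + 1)).Normal := tor_normal Γ _
    refine mem_tor_succ_of_pow_mem two_pos ?_
    have hq := h.map (QuotientGroup.mk' (tor Γ (m + 1)))
    have hmap : ∀ k, QuotientGroup.mk' (tor Γ (m + 1)) (conjPow t b k) =
        conjPow (QuotientGroup.mk' (tor Γ (m + 1)) t) (QuotientGroup.mk' (tor Γ (m + 1)) b) k :=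
      fun k => by simp only [conjPow, map_mul, map_pow, map_inv]
    rw [← QuotientGroup.eq_one_iff] at ih ⊢
    have ih' := (show QuotientGroup.mk' (tor Γ (m + 1)) _ = 1 from ih)
    change QuotientGroup.mk' (tor Γ (m + 1)) _ = 1
    simp only [map_pow, map_mul, map_inv, hmap] at ih' ⊢
    refine hq.sq_comm_eq_one ?_
    rwa [mul_inv_eq_one, mul_inv_eq_iff_eq_mul] at ih'

end TowerEquations

/-- The relators of the presentation with equations `TowerEquations`. -/
def towerRelators (v : Fin 8 → Γ) : List Γ :=
  [v 2 * (v 1 * v 1) * (v 1 * v 2)⁻¹, v 0 * v 3 * (v 3 * v 0)⁻¹, v 0 * v 4 * (v 4 * v 0)⁻¹,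
    v 0 * v 5 * (v 5 * v 0)⁻¹, v 1 * v 3 * (v 3 * v 1)⁻¹, v 1 * v 4 * (v 4 * v 1)⁻¹,
    v 1 * v 5 * (v 5 * v 1)⁻¹, v 2 * v 3 * (v 3 * v 2)⁻¹, v 2 * v 4 * (v 4 * v 2)⁻¹,
    v 2 * v 5 * (v 5 * v 2)⁻¹, v 6 * v 1 * (v 1 * v 6)⁻¹, v 6 * v 2 * (v 2 * v 6)⁻¹,
    v 7 * (v 0 * v 6 * v 0) * (v 0 * v 3 * v 7)⁻¹,
    v 7 * v 1 * (v 2 * v 1 * (v 2)⁻¹ * (v 5 * v 4 * (v 5)⁻¹) * v 7)⁻¹,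
    v 7 * v 2 * (v 2 * v 5 * v 7)⁻¹, (v 0 * v 1 * (v 0)⁻¹ * (v 1)⁻¹) ^ 2]

theorem map_towerRelators {Δ : Type*} [Group Δ] (φ : Γ →* Δ) (v : Fin 8 → Γ) :
    (towerRelators v).map φ = towerRelators (fun i => φ (v i)) := by
  simp only [towerRelators, List.map_cons, List.map_nil, map_mul, map_inv, map_pow]

theorem towerEquations_iff (v : Fin 8 → Γ) :
    TowerEquations (v 0) (v 1) (v 2) (v 3) (v 4) (v 5) (v 6) (v 7) ↔
      ∀ w ∈ towerRelators v, w = 1 := by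
  simp only [towerRelators, List.forall_mem_cons, List.not_mem_nil, false_imp_iff,
    implies_true, and_true, mul_inv_eq_one]
  constructor
  · rintro ⟨⟩
    refine ⟨?_, ?_, ?_, ?_, ?_, ?_, ?_, ?_, ?_, ?_, ?_, ?_, ?_, ?_, ?_, ?_⟩ <;> assumption
  · rintro ⟨_, _, _, _, _, _, _, _, _, _, _, _, _, _, _, _⟩
    constructor <;> assumption

end Tower

/-- The set of relators of `TowerGroup`. -/
def towerRels : Set (FreeGroup (Fin 8)) := {w | w ∈ towerRelators FreeGroup.of}

/-- A finitely presented group of torsion length `ω`. -/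
abbrev TowerGroup : Type := PresentedGroup towerRels

theorem TowerGroup.equations : TowerEquations (PresentedGroup.of 0 : TowerGroup)
    (PresentedGroup.of 1) (PresentedGroup.of 2) (PresentedGroup.of 3) (PresentedGroup.of 4)
    (PresentedGroup.of 5) (PresentedGroup.of 6) (PresentedGroup.of 7) := by
  refine (towerEquations_iff (fun i => (PresentedGroup.of i : TowerGroup))).2 ?_
  intro w hw
  have := map_towerRelators (PresentedGroup.mk towerRels) FreeGroup.of
  change _ = towerRelators (fun i => (PresentedGroup.of i : TowerGroup)) at this
  rw [← this, List.mem_map] at hw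
  obtain ⟨a, ha, rfl⟩ := hw
  exact PresentedGroup.one_of_mem ha

/-- The homomorphism out of `TowerGroup` given by a solution of the defining equations. -/
def TowerGroup.lift {Γ : Type*} [Group Γ] (v : Fin 8 → Γ)
    (h : TowerEquations (v 0) (v 1) (v 2) (v 3) (v 4) (v 5) (v 6) (v 7)) : TowerGroup →* Γ :=
  PresentedGroup.toGroup (f := v) (by
    intro w hw
    refine (towerEquations_iff v).1 h _ ?_
    have := map_towerRelators (FreeGroup.lift v) FreeGroup.of
    simp only [FreeGroup.lift_apply_of] at this
    rw [← this]
    exact List.mem_map_of_mem hw)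

@[simp]
theorem TowerGroup.lift_of {Γ : Type*} [Group Γ] (v : Fin 8 → Γ)
    (h : TowerEquations (v 0) (v 1) (v 2) (v 3) (v 4) (v 5) (v 6) (v 7)) (i : Fin 8) :
    TowerGroup.lift v h (PresentedGroup.of i) = v i := PresentedGroup.toGroup.of _

namespace DyadicAffine

/-- The homomorphism `P i → Q i`. -/
noncomputable def jP (i : ℕ) : P i →* Q i := (incQ i).comp (incPS i)

/-- Generators satisfying the tower equations in `Q i`. -/
noncomputable def towerGen (i : ℕ) : Fin 8 → Q i :=
  ![jP i (xP i), jP i (inP i trans), jP i (inP i half), jP i (incEP i (yE i)),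
    jP i (incEP i (inE i trans)), jP i (incEP i (inE i half)), incQ i (sPS i), rQ i]

theorem xP_mul_trans (i : ℕ) :
    xP i * inP i trans = zP i ^ 2 ^ i * inP i trans * xP i := by
  rw [← dy_pow i, map_pow, ← (zP_central i _).mul_pow]
  exact SemiconjBy.pow_right (xP_mul i) _

theorem xP_comm_trans_sq (i : ℕ) :
    (xP i * inP i trans * (xP i)⁻¹ * (inP i trans)⁻¹) ^ 2 = 1 := by
  rw [xP_mul_trans, mul_inv_cancel_right, mul_inv_cancel_right, ← pow_mul, mul_comm, pow_mul,
    zP_sq, one_pow]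

theorem xP_comm_dy (i : ℕ) :
    xP i * inP i (dy i) * (xP i)⁻¹ * (inP i (dy i))⁻¹ = zP i := by
  rw [xP_mul, mul_inv_cancel_right, mul_inv_cancel_right]

theorem rQ_mul_inR (i : ℕ) (a : OrderAut) :
    rQ i * jP i (inP i a) =
      jP i (inP i (half * a * half⁻¹)) * jP i (incEP i (inE i (half * a * half⁻¹))) * rQ i := by
  have := rQ_mul i (inR i a)
  rw [f₁_inR, f₂_inR, map_mul, map_mul] at this
  exact this

theorem towerEquations (i : ℕ) : TowerEquations (jP i (xP i)) (jP i (inP i trans))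
    (jP i (inP i half)) (jP i (incEP i (yE i))) (jP i (incEP i (inE i trans)))
    (jP i (incEP i (inE i half))) (incQ i (sPS i)) (rQ i) where
  half := by simp only [← map_mul, half_mul_trans]
  x_y := (commute_xP_incEP i _).map (jP i)
  x_c := (commute_xP_incEP i _).map (jP i)
  x_d := (commute_xP_incEP i _).map (jP i)
  b_y := (commute_inP_incEP i _ _).map (jP i)
  b_c := (commute_inP_incEP i _ _).map (jP i)
  b_d := (commute_inP_incEP i _ _).map (jP i)
  t_y := (commute_inP_incEP i _ _).map (jP i)
  t_c := (commute_inP_incEP i _ _).map (jP i)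
  t_d := (commute_inP_incEP i _ _).map (jP i)
  s_b := (commute_sPS i _).map (incQ i)
  s_t := (commute_sPS i _).map (incQ i)
  r_x := by
    have := rQ_mul i (uR i)
    rw [f₁_uR, f₂_uR] at this
    simp only [map_mul] at this
    exact this
  r_b := by
    have := rQ_mul_inR i trans
    simp only [map_mul, map_inv] at this ⊢
    exact this
  r_t := by simpa only [mul_inv_cancel_right] using rQ_mul_inR i half
  invol := by
    have := congrArg (jP i) (xP_comm_trans_sq i)
    simpa only [map_mul, map_pow, map_inv, map_one] using this

/-- The homomorphism from the tower group to `Q i`. -/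
noncomputable def ψ (i : ℕ) : TowerGroup →* Q i := TowerGroup.lift (towerGen i) (towerEquations i)

theorem mQ_jP (i : ℕ) (p : P i) : mQ i (jP i p) = jP (i + 1) (mP i p) := by
  simp [jP]

theorem mQ_ψ (i : ℕ) (g : TowerGroup) : mQ i (ψ i g) = ψ (i + 1) g := by
  have : (mQ i).comp (ψ i) = ψ (i + 1) := by
    refine PresentedGroup.ext fun k => ?_
    simp only [ψ, MonoidHom.comp_apply]
    fin_cases k
    all_goals simp [towerGen, mQ_jP]
  exact DFunLike.congr_fun this g

end DyadicAffine

open DyadicAffine in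
theorem TowerGroup.tor_lt_succ (m : ℕ) : tor TowerGroup m < tor TowerGroup (m + 1) := by
  refine lt_of_le_of_ne (tor_le_succ _ m) fun heq => ?_
  have h1 := TowerGroup.equations.comm_mem_tor m
  rw [← heq] at h1
  have h2 := tor_le_ker_of_tower ψ mQ mQ_ψ mQ_eq_one_of_pow_eq_one m h1
  have e0 : ψ m (PresentedGroup.of 0) = jP m (xP m) := TowerGroup.lift_of _ _ 0
  have e1 : ψ m (PresentedGroup.of 1) = jP m (inP m trans) := TowerGroup.lift_of _ _ 1
  have e2 : ψ m (PresentedGroup.of 2) = jP m (inP m half) := TowerGroup.lift_of _ _ 2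
  have e3 : ψ m (conjPow (PresentedGroup.of 2) (PresentedGroup.of 1) m) =
      jP m (inP m (dy m)) := by
    simp only [conjPow, map_mul, map_pow, map_inv, e1, e2, dy]
  rw [MonoidHom.mem_ker, map_mul, map_mul, map_mul, map_inv, map_inv, e3, e0] at h2
  have h3 := congrArg (jP m) (xP_comm_dy m)
  rw [map_mul, map_mul, map_mul, map_inv, map_inv, h2] at h3
  exact incQ_zP_ne_one m h3.symm

theorem tor_mono (G : Type*) [Group G] : Monotone (tor G) := monotone_nat_of_le_succ (tor_le_succ G)

theorem mem_tor_iff_of_mulEquiv {G H : Type*} [Group G] [Group H] (e : G ≃* H) (n : ℕ) (g : G) :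
    e g ∈ tor H n ↔ g ∈ tor G n :=
  ⟨fun h => by simpa using map_mem_tor e.symm.toMonoidHom n h, map_mem_tor e.toMonoidHom n⟩

open Monoid.Coprod in
theorem inr_mem_tor_iff {G H : Type*} [Group G] [Group H] (n : ℕ) (h : H) :
    (inr h : Monoid.Coprod G H) ∈ tor (Monoid.Coprod G H) n ↔ h ∈ tor H n :=
  ⟨fun hh => by simpa using map_mem_tor snd n hh, map_mem_tor (inr : H →* Monoid.Coprod G H) n⟩

open Monoid.Coprod in
theorem coprod_subgroup_eq_top {G H : Type*} [Group G] [Group H]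
    (N : Subgroup (Monoid.Coprod G H)) (hG : ∀ g, inl g ∈ N) (hH : ∀ h, inr h ∈ N) : N = ⊤ := by
  rw [eq_top_iff]
  rintro x -
  induction x using Monoid.Coprod.induction_on with
  | inl g => exact hG g
  | inr h => exact hH h
  | mul x y hx hy => exact mul_mem hx hy

theorem tor_coprod_eq_top {G H : Type*} [Group G] [Group H] {n : ℕ} (hG : tor G n = ⊤)
    (hH : tor H n = ⊤) : tor (Monoid.Coprod G H) n = ⊤ :=
  coprod_subgroup_eq_top _ (fun g => map_mem_tor _ n (by rw [hG]; trivial))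
    (fun h => map_mem_tor _ n (by rw [hH]; trivial))

open Monoid.Coprod in
/-- Adjoining a root to a group all of whose elements lie in `torₙ`. -/
theorem exists_fp_root {Q P : Type} [Group Q] [Group P] [Group.IsFinitelyPresented P] {n : ℕ}
    (hP : tor P n = ⊤) (f : P →* Q) (p : P) (q : Q) {k : ℕ} (hk : 0 < k) (hq : f p = q ^ k) :
    ∃ (P' : Type) (_ : Group P') (_ : Group.IsFinitelyPresented P') (f' : P' →* Q),
      tor P' (n + 1) = ⊤ ∧ q ∈ f'.range := by
  let y : Monoid.Coprod P (Multiplicative ℤ) := inr (Multiplicative.ofAdd 1)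
  let N : Subgroup (Monoid.Coprod P (Multiplicative ℤ)) :=
    Subgroup.normalClosure {y ^ k * (inl p)⁻¹}
  have hrel : (QuotientGroup.mk' N y) ^ k = QuotientGroup.mk' N (inl p) := by
    have h : QuotientGroup.mk' N (y ^ k * (inl p)⁻¹) = 1 :=
      (QuotientGroup.eq_one_iff _).2 (Subgroup.subset_normalClosure rfl)
    rwa [map_mul, map_inv, map_pow, mul_inv_eq_one] at h
  let F : Monoid.Coprod P (Multiplicative ℤ) →* Q := lift f (zpowersHom Q q)
  have hFy : F y = q := (lift_apply_inr _ _ _).trans (by simp)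
  have hF : N ≤ F.ker := Subgroup.normalClosure_le_normal (by
    rw [Set.singleton_subset_iff, SetLike.mem_coe, MonoidHom.mem_ker, map_mul, map_pow, map_inv,
      hFy, lift_apply_inl, hq, mul_inv_cancel])
  refine ⟨_ ⧸ N, inferInstance, Group.IsFinitelyPresented.quotient N
    ⟨_, Set.finite_singleton _, rfl⟩, QuotientGroup.lift N F hF, ?_, ?_⟩
  · have hl : ∀ a, QuotientGroup.mk' N (inl a) ∈ tor (_ ⧸ N) n := fun a =>
      map_mem_tor ((QuotientGroup.mk' N).comp inl) n (by rw [hP]; trivial)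
    have hy : QuotientGroup.mk' N y ∈ tor (_ ⧸ N) (n + 1) :=
      mem_tor_succ_of_pow_mem hk (by rw [hrel]; exact hl p)
    have htop : (tor (_ ⧸ N) (n + 1)).comap (QuotientGroup.mk' N) = ⊤ := by
      refine coprod_subgroup_eq_top _ (fun a => tor_le_succ _ n (hl a)) (fun z => ?_)
      have hz : (inr z : Monoid.Coprod P (Multiplicative ℤ)) = y ^ z.toAdd := by
        rw [← map_zpow, ← ofAdd_zsmul, smul_eq_mul, mul_one, ofAdd_toAdd]
      rw [Subgroup.mem_comap, hz, map_zpow]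
      exact zpow_mem hy _
    rw [eq_top_iff]
    rintro x -
    obtain ⟨c, rfl⟩ := QuotientGroup.mk'_surjective N x
    have : c ∈ (tor (_ ⧸ N) (n + 1)).comap (QuotientGroup.mk' N) := by rw [htop]; trivial
    exact this
  · exact ⟨QuotientGroup.mk' N y, hFy⟩

open Monoid.Coprod in
/-- Membership in `torₙ` is witnessed by a finitely presented group equal to its `torₙ`. -/
theorem exists_fp_of_mem_tor {Q : Type} [Group Q] (n : ℕ) : ∀ q ∈ tor Q n,
    ∃ (P : Type) (_ : Group P) (_ : Group.IsFinitelyPresented P) (f : P →* Q),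
      tor P n = ⊤ ∧ q ∈ f.range := by
  induction n with
  | zero =>
    intro q hq
    rw [tor, Subgroup.mem_bot] at hq
    exact ⟨Unit, inferInstance, inferInstance, 1, Subsingleton.elim _ _, hq ▸ one_mem _⟩
  | succ n ih =>
    intro q hq
    rw [tor, Subgroup.normalClosure] at hq
    induction hq using Subgroup.closure_induction with
    | mem q hq =>
      have hq' : ∃ k : ℕ, 0 < k ∧ q ^ k ∈ tor Q n := by
        obtain ⟨a, ⟨k, hk, ha⟩, hc⟩ := Group.mem_conjugatesOfSet_iff.1 hq
        obtain ⟨c, rfl⟩ := isConj_iff.1 hc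
        exact ⟨k, hk, by rw [conj_pow]; exact (tor_normal Q n).conj_mem _ ha c⟩
      obtain ⟨k, hk, hqk⟩ := hq'
      obtain ⟨P, _, _, f, hP, p, hp⟩ := ih _ hqk
      exact exists_fp_root hP f p q hk hp
    | one =>
      refine ⟨Unit, inferInstance, inferInstance, 1, Subsingleton.elim _ _, one_mem _⟩
    | mul a b _ _ ha hb =>
      obtain ⟨P₁, _, _, f₁, h₁, p₁, hp₁⟩ := ha
      obtain ⟨P₂, _, _, f₂, h₂, p₂, hp₂⟩ := hb
      exact ⟨Monoid.Coprod P₁ P₂, inferInstance, inferInstance, lift f₁ f₂,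
        tor_coprod_eq_top h₁ h₂, inl p₁ * inr p₂, by simp [hp₁, hp₂]⟩
    | inv a _ ha =>
      obtain ⟨P, i₁, i₂, f, h, hp⟩ := ha
      exact ⟨P, i₁, i₂, f, h, inv_mem hp⟩

/-- Left translation by a group element is a product of two involutions. -/
theorem exists_involution_mul_eq {H : Type*} [Group H] (x : H) :
    ∃ α : Equiv.Perm H, α ^ 2 = 1 ∧ (α * MulAction.toPermHom H H x) ^ 2 = 1 := by
  classical
  let s : H → H := fun g => (Quotient.mk (QuotientGroup.rightRel (Subgroup.zpowers x)) g).out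
  have hs : ∀ g h : H, h * g⁻¹ ∈ Subgroup.zpowers x → s g = s h := fun g h hgh =>
    congrArg Quotient.out (Quotient.sound (s := QuotientGroup.rightRel (Subgroup.zpowers x))
      (QuotientGroup.rightRel_apply.2 hgh))
  have hmem : ∀ g, g * (s g)⁻¹ ∈ Subgroup.zpowers x := fun g =>
    QuotientGroup.rightRel_apply.1
      (Quotient.mk_out (s := QuotientGroup.rightRel (Subgroup.zpowers x)) g)
  have hsα : ∀ g, s (s g * g⁻¹ * s g) = s g := fun g => (hs _ _ (by
    have := mul_mem (inv_mem (hmem g)) (inv_mem (hmem g))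
    simpa [mul_assoc] using this)).symm
  have hinv : Function.Involutive fun g => s g * g⁻¹ * s g := fun g => by
    simp only [hsα]
    group
  refine ⟨hinv.toPerm, ?_, ?_⟩
  · ext g
    exact hinv g
  · ext g
    have hx : ∀ a, s (x * a) = s a := fun a => (hs _ _ (by simp)).symm
    have h1 := hx g
    have h2 : s (x * (s g * (x * g)⁻¹ * s g)) = s g := by
      have h := hsα (x * g)
      rw [h1] at h
      exact (hx _).trans h
    have h3 : Commute x (g * (s g)⁻¹) := by
      obtain ⟨k, hk⟩ := hmem g
      rw [← hk]
      exact (Commute.refl x).zpow_right k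
    simp only [sq, Equiv.Perm.mul_apply, MulAction.toPermHom_apply, MulAction.toPerm_apply,
      smul_eq_mul, Function.Involutive.coe_toPerm, Equiv.Perm.one_apply, h1, h2]
    have h4 := h3.eq
    calc s g * (x * (s g * (x * g)⁻¹ * s g))⁻¹ * s g
        = (x * (g * (s g)⁻¹)) * x⁻¹ * s g := by group
      _ = g := by rw [h4]; group

/-- Every finitely presented group embeds into a finitely presented group generated by
involutions. -/
theorem exists_embedding_tor_one_eq_top {m : ℕ} (S : Finset (FreeGroup (Fin m))) :
    ∃ (E : Type) (_ : Group E) (_ : Group.IsFinitelyPresented E)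
      (ι : PresentedGroup (S : Set (FreeGroup (Fin m))) →* E),
      Function.Injective ι ∧ tor E 1 = ⊤ := by
  classical
  let H := PresentedGroup (S : Set (FreeGroup (Fin m)))
  let w : Fin m → FreeGroup (Fin m × Bool) := fun i =>
    FreeGroup.of (i, false) * FreeGroup.of (i, true)
  let rel : Set (FreeGroup (Fin m × Bool)) :=
    FreeGroup.lift w '' S ∪ Set.range fun z => FreeGroup.of z ^ 2
  have : Finite rel := ((S.finite_toSet.image _).union (Set.finite_range _)).to_subtype
  let ι : H →* PresentedGroup rel :=
    PresentedGroup.toGroup (f := fun i => PresentedGroup.mk rel (w i)) (by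
      intro r hr
      have : FreeGroup.lift (fun i => PresentedGroup.mk rel (w i)) =
          (PresentedGroup.mk rel).comp (FreeGroup.lift w) := by
        ext i
        simp
      rw [this]
      exact PresentedGroup.one_of_mem (Or.inl ⟨r, hr, rfl⟩))
  choose α hα hαx using fun i : Fin m => exists_involution_mul_eq (PresentedGroup.of i : H)
  let v : Fin m × Bool → Equiv.Perm H := fun z =>
    if z.2 then α z.1 * MulAction.toPermHom H H (PresentedGroup.of z.1) else α z.1
  have hvw : (FreeGroup.lift v).comp (FreeGroup.lift w) =
      (MulAction.toPermHom H H).comp (PresentedGroup.mk (S : Set (FreeGroup (Fin m)))) := by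
    refine FreeGroup.ext_hom _ _ fun i => ?_
    have h1 : α i * α i = 1 := by rw [← sq, hα]
    simp only [MonoidHom.comp_apply, FreeGroup.lift_apply_of, w, v, map_mul, if_true,
      Bool.false_eq_true, if_false]
    rw [← mul_assoc, h1, one_mul]
    rfl
  let ρ : PresentedGroup rel →* Equiv.Perm H := PresentedGroup.toGroup (f := v) (by
    rintro _ (⟨r, hr, rfl⟩ | ⟨⟨i, b⟩, rfl⟩)
    · have h1 := DFunLike.congr_fun hvw r
      have h2 : PresentedGroup.mk (S : Set (FreeGroup (Fin m))) r = 1 :=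
        PresentedGroup.one_of_mem hr
      rw [MonoidHom.comp_apply, MonoidHom.comp_apply, h2, map_one] at h1
      exact h1
    · cases b
      · simpa [v] using hα i
      · simpa [v] using hαx i)
  have hρι : ρ.comp ι = MulAction.toPermHom H H := by
    refine PresentedGroup.ext fun i => ?_
    have := DFunLike.congr_fun hvw (FreeGroup.of i)
    simp only [MonoidHom.comp_apply, FreeGroup.lift_apply_of] at this
    simp only [MonoidHom.comp_apply, ι, PresentedGroup.toGroup.of]
    exact this
  refine ⟨PresentedGroup rel, inferInstance, inferInstance, ι, ?_, ?_⟩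
  · have hinj : Function.Injective (ρ.comp ι) := by
      rw [hρι]
      exact MulAction.toPerm_injective
    exact Function.Injective.of_comp (f := ρ) hinj
  · rw [eq_top_iff, ← PresentedGroup.closure_range_of, Subgroup.closure_le]
    rintro _ ⟨z, rfl⟩
    refine mem_tor_succ_of_pow_mem two_pos ?_
    rw [tor, Subgroup.mem_bot]
    exact PresentedGroup.one_of_mem (rels := rel) (Or.inr ⟨z, rfl⟩)

theorem exists_mulEquiv_presentedGroup_finset (G : Type*) [Group G]
    [Group.IsFinitelyPresented G] : ∃ (j : ℕ) (T : Finset (FreeGroup (Fin j))),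
      Nonempty (G ≃* PresentedGroup (T : Set (FreeGroup (Fin j)))) := by
  obtain ⟨j, s, hs, h⟩ := Group.IsFinitelyPresented.exists_mulEquiv_presentedGroup (G := G)
  exact ⟨j, hs.toFinset, by rwa [hs.coe_toFinset]⟩

instance : Group.IsFinitelyPresented TowerGroup := by
  have : Finite towerRels := (List.finite_toSet _).to_subtype
  infer_instance

/-- Remark: every finitely presented group `H` embeds into a finitely presented group of
torsion length `n`, for every ordinal `1 ≤ n ≤ ω`. Here the finite case `n ≥ 1`
(`tor_{n-1}(G) ≠ tor_n(G) = tor_{n+1}(G)`) and the case `ω` (a strictly increasing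
torsion chain) are stated separately. -/
theorem embeds_into_fp_group_of_any_torlen (H : Type*) [Group H]
    (hH : IsFinitelyPresentedGroup H) (n : ℕ) (hn : 1 ≤ n) :
    (∃ (j : ℕ) (T : Finset (FreeGroup (Fin j)))
      (ι : H →* PresentedGroup (T : Set (FreeGroup (Fin j)))),
      Function.Injective ι ∧
      tor (PresentedGroup (T : Set (FreeGroup (Fin j)))) (n - 1) ≠
        tor (PresentedGroup (T : Set (FreeGroup (Fin j)))) n ∧
      tor (PresentedGroup (T : Set (FreeGroup (Fin j)))) n =
        tor (PresentedGroup (T : Set (FreeGroup (Fin j)))) (n + 1)) ∧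
    (∃ (j : ℕ) (T : Finset (FreeGroup (Fin j)))
      (ι : H →* PresentedGroup (T : Set (FreeGroup (Fin j)))),
      Function.Injective ι ∧
      ∀ m : ℕ,
        tor (PresentedGroup (T : Set (FreeGroup (Fin j)))) m <
          tor (PresentedGroup (T : Set (FreeGroup (Fin j)))) (m + 1)) := by
  obtain ⟨m, S, ⟨e⟩⟩ := hH
  constructor
  · obtain ⟨E, _, _, ι, hι, hE⟩ := exists_embedding_tor_one_eq_top S
    obtain ⟨k, rfl⟩ : ∃ k, n = k + 1 := ⟨n - 1, by omega⟩
    obtain ⟨q, hq, hqk⟩ := SetLike.exists_of_lt (TowerGroup.tor_lt_succ k)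
    obtain ⟨P, _, _, f, hP, p, rfl⟩ := exists_fp_of_mem_tor (k + 1) q hq
    have hp : p ∉ tor P k := fun h => hqk (map_mem_tor f k h)
    have htop : tor (Monoid.Coprod E P) (k + 1) = ⊤ :=
      tor_coprod_eq_top (top_le_iff.1 (hE ▸ tor_mono E (by omega))) hP
    obtain ⟨j, T, ⟨φ⟩⟩ := exists_mulEquiv_presentedGroup_finset (Monoid.Coprod E P)
    refine ⟨j, T, φ.toMonoidHom.comp (Monoid.Coprod.inl.comp (ι.comp e.toMonoidHom)),
      φ.injective.comp (Monoid.Coprod.inl_injective.comp (hι.comp e.injective)),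
      fun h => hp ?_, le_antisymm (tor_le_succ _ _) fun g _ => ?_⟩
    · rw [← inr_mem_tor_iff (G := E), ← mem_tor_iff_of_mulEquiv φ]
      rw [Nat.add_sub_cancel] at h
      rw [h, mem_tor_iff_of_mulEquiv, htop]
      trivial
    · obtain ⟨g, rfl⟩ := φ.surjective g
      rw [mem_tor_iff_of_mulEquiv, htop]
      trivial
  · have : Group.IsFinitelyPresented H := Group.IsFinitelyPresented.equiv e.symm
    obtain ⟨j, T, ⟨φ⟩⟩ := exists_mulEquiv_presentedGroup_finset (Monoid.Coprod H TowerGroup)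
    refine ⟨j, T, φ.toMonoidHom.comp Monoid.Coprod.inl,
      φ.injective.comp Monoid.Coprod.inl_injective, fun m =>
      lt_of_le_of_ne (tor_le_succ _ _) fun h => ?_⟩
    obtain ⟨q, hq, hqm⟩ := SetLike.exists_of_lt (TowerGroup.tor_lt_succ m)
    refine hqm ?_
    rw [← inr_mem_tor_iff (G := H), ← mem_tor_iff_of_mulEquiv φ, h, mem_tor_iff_of_mulEquiv,
      inr_mem_tor_iff]
    exact hq
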